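/- For τ ∈ 𝔽_qˣ (q odd), the group Γ_τ = ⟨PA_τ⟩ is a free group of rank (q+1)/2. More precisely, [1 + α·j]⁻¹ = [1 − α·j] for every α with N(α) = τ⁻¹, and there is a subset T ⊆ PA_τ with (q+1)/2 elements such that PA_τ = T ∪ T⁻¹ and Γ_τ is freely generated by T; in particular Γ_τ is isomorphic to the free group on (q+1)/2 generators. -/

import Mathlib

open Polynomial Quaternion

noncomputable section

/-- The multiplicative set of `𝔽_q[t]` generated by `t` and `t - τ` for `τ ∈ S₀`. -/
def sden (F : Type) [Field F] (S₀ : Set F) : Submonoid F[X] :=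
  Submonoid.closure ({X} ∪ (fun τ : F => X - C τ) '' S₀)

/-- The ring `o_S`, the localization of `𝔽_q[t]` inverting `t` and `t - τ` for `τ ∈ S₀`. -/
abbrev OS (F : Type) [Field F] (S₀ : Set F) := Localization (sden F S₀)

/-- The quaternion algebra `ℍ[o_S, c, t]` with `i² = c`, `j² = t`, `ij = -ji = k`. -/
abbrev QAS (F : Type) [Field F] (S₀ : Set F) (c : F) : Type :=
  ℍ[OS F S₀, algebraMap F[X] (OS F S₀) (C c), algebraMap F[X] (OS F S₀) X]

/-- The central subgroup of scalar units. -/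
def scalarUnits (R A : Type*) [CommRing R] [Ring A] [Algebra R A] : Subgroup Aˣ :=
  (Units.map (algebraMap R A).toMonoidHom).range

instance scalarUnits_normal (R A : Type*) [CommRing R] [Ring A] [Algebra R A] :
    (scalarUnits R A).Normal := by
  constructor
  intro n hn g
  obtain ⟨r, rfl⟩ := hn
  refine ⟨r, ?_⟩
  ext
  simp only [Units.val_mul, Units.coe_map, RingHom.toMonoidHom_eq_coe, MonoidHom.coe_coe]
  rw [← Algebra.commutes (r : R) ((g : Aˣ) : A), mul_assoc, Units.mul_inv, mul_one]

/-- The group `Λ_S = ℍ[o_S, c, t]ˣ/o_Sˣ`. -/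
abbrev LambdaS (F : Type) [Field F] (S₀ : Set F) (c : F) : Type :=
  (QAS F S₀ c)ˣ ⧸ scalarUnits (OS F S₀) (QAS F S₀ c)

/-- The class `[w]` of a unit `w`. -/
abbrev clsS (F : Type) [Field F] (S₀ : Set F) (c : F) : (QAS F S₀ c)ˣ →* LambdaS F S₀ c :=
  QuotientGroup.mk' _

/-- The canonical map `F → o_S`. -/
def toOS (F : Type) [Field F] (S₀ : Set F) : F →+* OS F S₀ :=
  (algebraMap F[X] (OS F S₀)).comp (C : F →+* F[X])

/-- The quaternion `1 + α·j = 1 + x·j + y·k` for `α = x + y·√c ∈ 𝔽_{q²}`. -/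
def oneAddJ (F : Type) [Field F] (S₀ : Set F) (c : F) (x y : F) : QAS F S₀ c :=
  ⟨1, 0, toOS F S₀ x, toOS F S₀ y⟩

/-- `α = x + y·√c` in `𝔽_{q²} = F(√c)`. -/
def hasCoord (F : Type) [Field F] (E : Type) [Field E] [Algebra F E] (s : E)
    (α : E) (x y : F) : Prop :=
  α = algebraMap F E x + algebraMap F E y * s

/-- The set `PA_τ = {[1 + α·j] : α ∈ 𝔽_{q²}, N(α) = α^{q+1} = τ⁻¹} ⊆ Λ_S`. -/
def PASet (F : Type) [Field F] [Fintype F] (E : Type) [Field E] [Algebra F E] (s : E)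
    (S₀ : Set F) (c : F) (τ : F) : Set (LambdaS F S₀ c) :=
  {z | ∃ (α : E) (x y : F) (w : (QAS F S₀ c)ˣ),
    hasCoord F E s α x y ∧
    α ^ (Fintype.card F + 1) = algebraMap F E τ⁻¹ ∧
    (w : QAS F S₀ c) = oneAddJ F S₀ c x y ∧
    z = clsS F S₀ c w}

/-- The group `Γ_S`, generated by all `PA_τ`, `τ ∈ S₀`. -/
def GammaS (F : Type) [Field F] [Fintype F] (E : Type) [Field E] [Algebra F E] (s : E)
    (S₀ : Set F) (c : F) : Subgroup (LambdaS F S₀ c) :=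
  Subgroup.closure (⋃ τ ∈ S₀, PASet F E s S₀ c τ)


namespace FreeGroup

/-- A family symmetric under inversion, none of whose nonempty reduced words is trivial, is
injective. -/
theorem injective_of_chain_prod_ne_one {G S : Type*} [Group G] {u : S → G} {ν : S → S}
    (hν : Function.Involutive ν) (hu : ∀ a, u (ν a) = (u a)⁻¹)
    (hprod : ∀ L : List S, L ≠ [] → L.IsChain (fun a b => a ≠ ν b) → (L.map u).prod ≠ 1) :
    Function.Injective u := by
  intro a b hab
  by_contra hne
  refine hprod [a, ν b] (by simp) ?_ ?_
  · simpa [hν b] using hne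
  · simp [hu, hab]

/-- If no nonempty reduced word in the family `u` is trivial, then a
subfamily meeting each pair `{a, ν a}` at most once freely generates. -/
theorem lift_injective_of_chain_prod_ne_one {G S ι : Type*} [Group G] {u : S → G} {ν : S → S}
    (hν : Function.Involutive ν) (hu : ∀ a, u (ν a) = (u a)⁻¹)
    (hprod : ∀ L : List S, L ≠ [] → L.IsChain (fun a b => a ≠ ν b) → (L.map u).prod ≠ 1)
    {f : ι → S} (hf : Function.Injective f) (hfν : ∀ i j, f i ≠ ν (f j)) :
    Function.Injective (lift (u ∘ f)) := by
  classical
  rw [injective_iff_map_eq_one]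
  intro x hx
  by_contra hne
  let φ : ι × Bool → S := fun p => cond p.2 (f p.1) (ν (f p.1))
  refine hprod (x.toWord.map φ) ?_ ?_ ?_
  · simpa [toWord_eq_nil_iff] using hne
  · rw [List.isChain_map]
    refine List.IsChain.imp ?_ (isReduced_toWord (x := x))
    rintro ⟨i, b⟩ ⟨j, b'⟩ h
    cases b <;> cases b' <;> simp only [φ, cond_true, cond_false, hν _]
    · exact fun h' => hfν j i h'.symm
    · intro h'
      simpa using h (hf (hν.injective h'))
    · intro h'
      simpa using h (hf h')
    · exact hfν i j
  · rw [← mk_toWord (x := x), lift_mk] at hx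
    rw [List.map_map, ← hx]
    congr 1
    refine List.map_congr_left ?_
    rintro ⟨i, b⟩ -
    cases b <;> simp [φ, hu]

end FreeGroup

/-- A fixed-point-free involution on a finite type has a transversal of half the size. -/
theorem Function.Involutive.exists_transversal {S : Type*} [Finite S] {ν : S → S}
    (hν : Function.Involutive ν) (hfix : ∀ a, ν a ≠ a) :
    ∃ T : Set S, 2 * T.ncard = Nat.card S ∧ T ∪ ν '' T = Set.univ ∧
      ∀ a ∈ T, ∀ b ∈ T, a ≠ ν b := by
  classical
  obtain ⟨n, ⟨e⟩⟩ := Finite.exists_equiv_fin S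
  let T : Set S := {a | e a < e (ν a)}
  have hunion : T ∪ ν '' T = Set.univ := by
    refine Set.eq_univ_of_forall fun a => ?_
    rcases lt_trichotomy (e a) (e (ν a)) with h | h | h
    · exact Or.inl h
    · exact absurd (e.injective h).symm (hfix a)
    · exact Or.inr ⟨ν a, by simpa [T, hν a] using h, hν a⟩
  have hdisj : ∀ a ∈ T, ∀ b ∈ T, a ≠ ν b := by
    rintro a ha b hb rfl
    have ha' : e (ν b) < e (ν (ν b)) := ha
    rw [hν b] at ha'
    exact lt_asymm ha' hb
  refine ⟨T, ?_, hunion, hdisj⟩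
  have hd : Disjoint T (ν '' T) := by
    rw [Set.disjoint_left]
    rintro a ha ⟨b, hb, rfl⟩
    exact hdisj _ ha b hb rfl
  rw [← Set.ncard_univ, ← hunion, Set.ncard_union_eq hd, Set.ncard_image_of_injective _ hν.injective,
    two_mul]

namespace FreeGroup

theorem exists_free_transversal {G S : Type*} [Group G] [Finite S] {u : S → G} {ν : S → S}
    (hν : Function.Involutive ν) (hfix : ∀ a, ν a ≠ a) (hu : ∀ a, u (ν a) = (u a)⁻¹)
    (hprod : ∀ L : List S, L ≠ [] → L.IsChain (fun a b => a ≠ ν b) → (L.map u).prod ≠ 1) :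
    ∃ T : Set G, 2 * T.ncard = Nat.card S ∧ Set.range u = T ∪ T⁻¹ ∧
      Function.Injective (lift (Subtype.val : T → G)) := by
  obtain ⟨T, hcard, hunion, hdisj⟩ := hν.exists_transversal hfix
  have hinj := injective_of_chain_prod_ne_one hν hu hprod
  refine ⟨u '' T, ?_, ?_, ?_⟩
  · rwa [Set.ncard_image_of_injective _ hinj]
  · rw [← Set.image_univ, ← hunion, Set.image_union, Set.image_image, ← Set.image_inv_eq_inv,
      Set.image_image]
    simp only [hu]
  · choose f hfT hf using fun x : (u '' T : Set G) => x.2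
    have hval : (Subtype.val : (u '' T : Set G) → G) = u ∘ f := funext fun x => (hf x).symm
    rw [hval]
    refine lift_injective_of_chain_prod_ne_one hν hu hprod ?_
      fun i j => hdisj _ (hfT i) _ (hfT j)
    intro x y hxy
    exact Subtype.ext (by rw [← hf x, ← hf y, hxy])

end FreeGroup

section QuadraticNorm

variable {F : Type} [Field F]

theorem eq_zero_of_sq_sub_mul_sq_eq_zero {c : F} (hc : ¬IsSquare c) {x y : F}
    (h : x ^ 2 - c * y ^ 2 = 0) : x = 0 ∧ y = 0 := by
  have hy : y = 0 := by
    by_contra hy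
    refine hc ⟨x / y, ?_⟩
    field_simp
    linear_combination -h
  subst hy
  simpa using h

variable {E : Type} [Field E] [Algebra F E] {c : F} {s : E}

theorem coord_injective (hc : ¬IsSquare c) (hs : s ^ 2 = algebraMap F E c) :
    Function.Injective
      (fun p : F × F => algebraMap F E p.1 + algebraMap F E p.2 * s) := by
  rintro ⟨x, y⟩ ⟨x', y'⟩ h
  have h0 : (x - x') ^ 2 - c * (y - y') ^ 2 = 0 := by
    apply (algebraMap F E).injective
    simp only [map_sub, map_mul, map_pow, map_zero, ← hs]
    simp only at h
    linear_combination (algebraMap F E x - algebraMap F E x' -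
      (algebraMap F E y - algebraMap F E y') * s) * h
  obtain ⟨h1, h2⟩ := eq_zero_of_sq_sub_mul_sq_eq_zero hc h0
  exact Prod.ext (sub_eq_zero.mp h1) (sub_eq_zero.mp h2)

variable [Fintype F]

theorem ringChar_ne_two_of_odd_card (hq : Odd (Fintype.card F)) : ringChar F ≠ 2 := by
  intro h
  have := FiniteField.even_card_of_char_two h
  rw [Nat.odd_iff] at hq
  omega

theorem coord_pow_card_add_one (hq : Odd (Fintype.card F)) (hc : ¬IsSquare c)
    (hs : s ^ 2 = algebraMap F E c) (x y : F) :
    (algebraMap F E x + algebraMap F E y * s) ^ (Fintype.card F + 1) =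
      algebraMap F E (x ^ 2 - c * y ^ 2) := by
  have hF := ringChar_ne_two_of_odd_card hq
  have hc0 : c ≠ 0 := fun h => hc (h ▸ IsSquare.zero)
  have hpow : c ^ (Fintype.card F / 2) = -1 :=
    (FiniteField.pow_dichotomy hF hc0).resolve_left
      fun h => hc ((FiniteField.isSquare_iff hF hc0).mpr h)
  have hsq : s ^ Fintype.card F = -s := by
    conv_lhs => rw [← Nat.two_mul_div_two_add_one_of_odd hq]
    rw [pow_succ, pow_mul, hs, ← map_pow, hpow]
    simp
  have hfrob : (algebraMap F E x + algebraMap F E y * s) ^ Fintype.card F =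
      algebraMap F E x - algebraMap F E y * s := by
    have := map_add (FiniteField.frobeniusAlgHom F E) (algebraMap F E x) (algebraMap F E y * s)
    simp only [FiniteField.coe_frobeniusAlgHom] at this
    rw [this, mul_pow, hsq, ← map_pow, ← map_pow, FiniteField.pow_card, FiniteField.pow_card]
    ring
  rw [pow_succ, hfrob]
  simp only [map_sub, map_mul, map_pow, ← hs]
  ring

theorem exists_sq_sub_mul_sq_eq (hq : Odd (Fintype.card F)) (hc0 : c ≠ 0) (d : F) :
    ∃ x y : F, x ^ 2 - c * y ^ 2 = d := by
  have h2 : (C (-c) * X ^ 2 + C 0 * X + C (-d) : F[X]).degree = 2 :=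
    degree_quadratic (neg_ne_zero.mpr hc0)
  obtain ⟨x, y, h⟩ := FiniteField.exists_root_sum_quadratic (degree_X_pow (R := F) 2) h2
    (Nat.odd_iff.mp hq)
  refine ⟨x, y, ?_⟩
  simp at h
  linear_combination h

theorem card_sq_sub_mul_sq_eq (hq : Odd (Fintype.card F)) (hc : ¬IsSquare c)
    (hs : s ^ 2 = algebraMap F E c) (hspan : ∀ α : E, ∃ x y : F, hasCoord F E s α x y)
    {d : F} (hd : d ≠ 0) :
    Nat.card {p : F × F // p.1 ^ 2 - c * p.2 ^ 2 = d} = Fintype.card F + 1 := by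
  classical
  let φ : F × F ≃ E := Equiv.ofBijective _ ⟨coord_injective hc hs, fun α => by
    obtain ⟨x, y, h⟩ := hspan α
    exact ⟨(x, y), h.symm⟩⟩
  have hφ : ∀ p, φ p ^ (Fintype.card F + 1) = algebraMap F E (p.1 ^ 2 - c * p.2 ^ 2) :=
    fun p => coord_pow_card_add_one hq hc hs p.1 p.2
  have : Finite E := Finite.of_equiv _ φ
  have hcardE : Nat.card E = Fintype.card F * Fintype.card F := by
    rw [← Nat.card_congr φ, Nat.card_prod, Nat.card_eq_fintype_card]
  have hq1 : 1 < Fintype.card F := Fintype.one_lt_card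
  obtain ⟨g, hg⟩ := IsCyclic.exists_ofOrder_eq_natCard (α := Eˣ)
  have hg' : IsPrimitiveRoot g (Nat.card Eˣ) := hg ▸ IsPrimitiveRoot.orderOf g
  have hζ : IsPrimitiveRoot ((g ^ (Fintype.card F - 1) : Eˣ) : E) (Fintype.card F + 1) := by
    refine IsPrimitiveRoot.coe_units_iff.mpr (hg'.pow Nat.card_pos ?_)
    rw [Nat.card_units, hcardE]
    obtain ⟨m, hm⟩ := Nat.exists_eq_add_of_lt hq1
    rw [hm]
    simp only [Nat.add_sub_cancel]
    have : (1 + m + 1) * (1 + m + 1) = (1 + m) * (1 + m + 1 + 1) + 1 := by ring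
    rw [this]
    simp [add_comm]
  obtain ⟨x, y, hxy⟩ := exists_sq_sub_mul_sq_eq (c := c) hq (fun h => hc (h ▸ IsSquare.zero)) d
  have hd' : algebraMap F E d ≠ 0 := by simpa using hd
  have hroots := hζ.card_nthRoots (algebraMap F E d)
  rw [if_pos ⟨φ (x, y), by rw [hφ, hxy]⟩] at hroots
  rw [← hroots, ← Multiset.toFinset_card_of_nodup (hζ.nthRoots_nodup hd'), ← Fintype.card_coe,
    ← Nat.card_eq_fintype_card]
  refine Nat.card_congr (φ.subtypeEquiv fun p => ?_)
  rw [Multiset.mem_toFinset, mem_nthRoots (Nat.succ_pos _), hφ, (algebraMap F E).injective.eq_iff]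

end QuadraticNorm

section Words

variable {F : Type} [Field F]

theorem sden_le_nonZeroDivisors (S₀ : Set F) : sden F S₀ ≤ nonZeroDivisors F[X] := by
  rw [sden, Submonoid.closure_le]
  rintro p (rfl | ⟨a, -, rfl⟩)
  · exact mem_nonZeroDivisors_of_ne_zero X_ne_zero
  · exact mem_nonZeroDivisors_of_ne_zero (X_sub_C_ne_zero a)

theorem algebraMap_OS_injective (S₀ : Set F) :
    Function.Injective (algebraMap F[X] (OS F S₀)) :=
  IsLocalization.injective _ (sden_le_nonZeroDivisors S₀)

theorem oneAddJ_mul_oneAddJ_neg (S₀ : Set F) (c x y : F) :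
    oneAddJ F S₀ c x y * oneAddJ F S₀ c (-x) (-y) =
      algebraMap (OS F S₀) (QAS F S₀ c)
        (algebraMap F[X] (OS F S₀) (1 - C (x ^ 2 - c * y ^ 2) * X)) := by
  ext <;> simp [oneAddJ, toOS, QuaternionAlgebra.algebraMap_eq] <;> ring

theorem isUnit_one_sub_C_inv_mul_X {τ : F} (hτ : τ ≠ 0) :
    IsUnit (algebraMap F[X] (OS F {τ}) (1 - C τ⁻¹ * X)) := by
  have h : (1 - C τ⁻¹ * X : F[X]) = C (-τ⁻¹) * (X - C τ) := by
    rw [mul_sub, ← C_mul, neg_mul, inv_mul_cancel₀ hτ]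
    simp only [C_neg, C_1]
    ring
  rw [h, map_mul]
  refine IsUnit.mul (((isUnit_C.mpr (by simpa using hτ))).map _) ?_
  exact IsLocalization.map_units _
    (⟨X - C τ, Submonoid.subset_closure (Or.inr ⟨τ, rfl, rfl⟩)⟩ : sden F {τ})

theorem isUnit_oneAddJ {τ : F} (hτ : τ ≠ 0) {c x y : F} (h : x ^ 2 - c * y ^ 2 = τ⁻¹) :
    IsUnit (oneAddJ F {τ} c x y) := by
  have key := (isUnit_one_sub_C_inv_mul_X hτ).map (algebraMap (OS F {τ}) (QAS F {τ} c))
  have h1 := oneAddJ_mul_oneAddJ_neg {τ} c x y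
  have h2 := oneAddJ_mul_oneAddJ_neg {τ} c (-x) (-y)
  rw [h] at h1
  rw [neg_sq, neg_sq, neg_neg, neg_neg, h] at h2
  have hcomm : Commute (oneAddJ F {τ} c x y) (oneAddJ F {τ} c (-x) (-y)) := h1.trans h2.symm
  exact (hcomm.isUnit_mul_iff.mp (h1 ▸ key)).1

theorem clsS_inv_eq {τ : F} (hτ : τ ≠ 0) {c x y : F} (h : x ^ 2 - c * y ^ 2 = τ⁻¹)
    {w w' : (QAS F {τ} c)ˣ} (hw : (w : QAS F {τ} c) = oneAddJ F {τ} c x y)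
    (hw' : (w' : QAS F {τ} c) = oneAddJ F {τ} c (-x) (-y)) :
    (clsS F {τ} c w)⁻¹ = clsS F {τ} c w' := by
  rw [inv_eq_iff_mul_eq_one, ← map_mul, QuotientGroup.mk'_apply, QuotientGroup.eq_one_iff]
  refine ⟨(isUnit_one_sub_C_inv_mul_X hτ).unit, ?_⟩
  ext1
  rw [Units.val_mul, hw, hw', oneAddJ_mul_oneAddJ_neg, h]
  rfl

/-- A reduced product of quaternions `1 + α·j` with `N(α) = τ⁻¹` has polynomial coordinates, and
at `t = τ` it specializes to `a + α·ā·j`, where `α·j` comes from the first factor and `a ≠ 0`. -/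
theorem exists_coord_prod_oneAddJ {τ : F} (hτ : τ ≠ 0) {c : F} (hc : ¬IsSquare c)
    (L : List (F × F)) (a : F × F)
    (hL : ∀ p ∈ a :: L, p.1 ^ 2 - c * p.2 ^ 2 = τ⁻¹)
    (hchain : (a :: L).IsChain (fun p p' => p ≠ -p')) :
    ∃ p₀ p₁ p₂ p₃ : F[X],
      ((a :: L).map fun p => oneAddJ F {τ} c p.1 p.2).prod =
        ⟨algebraMap _ _ p₀, algebraMap _ _ p₁, algebraMap _ _ p₂, algebraMap _ _ p₃⟩ ∧
      p₀.eval τ ^ 2 - c * p₁.eval τ ^ 2 ≠ 0 ∧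
      p₂.eval τ = a.1 * p₀.eval τ - c * a.2 * p₁.eval τ ∧
      p₃.eval τ = a.2 * p₀.eval τ - a.1 * p₁.eval τ := by
  induction L generalizing a with
  | nil =>
    refine ⟨1, 0, C a.1, C a.2, ?_, by simp, by simp, by simp⟩
    simp [oneAddJ, toOS]
  | cons b L ih =>
    obtain ⟨hab, hchain⟩ := List.isChain_cons_cons.mp hchain
    obtain ⟨p₀, p₁, p₂, p₃, hprod, hne, h₂, h₃⟩ :=
      ih b (fun p hp => hL p (List.mem_cons_of_mem _ hp)) hchain
    have ha := hL a (by simp)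
    have hb := hL b (by simp)
    refine ⟨p₀ + X * (C a.1 * p₂ - C c * C a.2 * p₃), p₁ + X * (C a.2 * p₂ - C a.1 * p₃),
      p₂ + C a.1 * p₀ - C c * C a.2 * p₁, p₃ + C a.2 * p₀ - C a.1 * p₁, ?_, ?_, ?_, ?_⟩
    · rw [List.map_cons, List.prod_cons, hprod]
      ext <;> simp [oneAddJ, toOS] <;> ring
    · have hτa : τ * (a.1 ^ 2 - c * a.2 ^ 2) = 1 := by rw [ha, mul_inv_cancel₀ hτ]
      have hτb : τ * (b.1 ^ 2 - c * b.2 ^ 2) = 1 := by rw [hb, mul_inv_cancel₀ hτ]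
      have hsum : (a.1 + b.1) ^ 2 - c * (a.2 + b.2) ^ 2 ≠ 0 := by
        intro h
        obtain ⟨h1, h2⟩ := eq_zero_of_sq_sub_mul_sq_eq_zero hc h
        exact hab (Prod.ext (eq_neg_of_add_eq_zero_left h1) (eq_neg_of_add_eq_zero_left h2))
      have hmul : (p₀.eval τ ^ 2 - c * p₁.eval τ ^ 2) *
          (τ * ((a.1 + b.1) ^ 2 - c * (a.2 + b.2) ^ 2)) ≠ 0 :=
        mul_ne_zero hne (mul_ne_zero hτ hsum)
      convert hmul using 1
      simp only [eval_add, eval_sub, eval_mul, eval_X, eval_C, h₂, h₃]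
      linear_combination (p₀.eval τ ^ 2 - c * p₁.eval τ ^ 2) *
        ((τ * (b.1 ^ 2 - c * b.2 ^ 2) - 1) * hτa)
    · simp only [eval_add, eval_sub, eval_mul, eval_X, eval_C, h₂, h₃]
      have hτa : τ * (a.1 ^ 2 - c * a.2 ^ 2) = 1 := by rw [ha, mul_inv_cancel₀ hτ]
      linear_combination (-(b.1 * p₀.eval τ - c * b.2 * p₁.eval τ)) * hτa
    · simp only [eval_add, eval_sub, eval_mul, eval_X, eval_C, h₂, h₃]
      have hτa : τ * (a.1 ^ 2 - c * a.2 ^ 2) = 1 := by rw [ha, mul_inv_cancel₀ hτ]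
      linear_combination (-(b.2 * p₀.eval τ - b.1 * p₁.eval τ)) * hτa

theorem prod_oneAddJ_ne_algebraMap {τ : F} (hτ : τ ≠ 0) {c : F} (hc : ¬IsSquare c)
    {L : List (F × F)} (hnil : L ≠ []) (hL : ∀ p ∈ L, p.1 ^ 2 - c * p.2 ^ 2 = τ⁻¹)
    (hchain : L.IsChain (fun p p' => p ≠ -p')) (r : OS F {τ}) :
    (L.map fun p => oneAddJ F {τ} c p.1 p.2).prod ≠ algebraMap _ (QAS F {τ} c) r := by
  obtain ⟨a, L, rfl⟩ := List.exists_cons_of_ne_nil hnil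
  obtain ⟨p₀, p₁, p₂, p₃, hprod, hne, h₂, h₃⟩ := exists_coord_prod_oneAddJ hτ hc L a hL hchain
  rw [hprod, QuaternionAlgebra.algebraMap_eq]
  intro h
  obtain ⟨-, -, hJ, hK⟩ := QuaternionAlgebra.mk.inj h
  rw [map_eq_zero_iff _ (algebraMap_OS_injective {τ})] at hJ hK
  rw [hJ, eval_zero] at h₂
  rw [hK, eval_zero] at h₃
  refine mul_ne_zero (inv_ne_zero hτ) hne ?_
  rw [← hL a (by simp)]
  linear_combination (-(a.1 * p₀.eval τ - c * a.2 * p₁.eval τ)) * h₂ +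
    c * (a.2 * p₀.eval τ - a.1 * p₁.eval τ) * h₃

end Words

/-- For `τ ∈ 𝔽_qˣ` (`q` odd), `Γ_τ = ⟨PA_τ⟩` is a free group of rank
`(q+1)/2`: one has `[1 + α·j]⁻¹ = [1 - α·j]`, and there is a subset `T ⊆ PA_τ` with
`(q+1)/2` elements such that `PA_τ = T ∪ T⁻¹` and `Γ_τ` is freely generated by `T`;
in particular `Γ_τ` is isomorphic to the free group on `(q+1)/2` generators. -/
theorem gammaTau_free
    (F : Type) [Field F] [Fintype F] (hq : Odd (Fintype.card F))
    (c : F) (hc : ¬IsSquare c)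
    (E : Type) [Field E] [Algebra F E] (s : E)
    (hs : s ^ 2 = algebraMap F E c)
    (hspan : ∀ α : E, ∃ x y : F, hasCoord F E s α x y)
    (τ : F) (hτ : τ ≠ 0) :
    (∀ (α : E) (x y : F) (w w' : (QAS F {τ} c)ˣ),
        hasCoord F E s α x y →
        α ^ (Fintype.card F + 1) = algebraMap F E τ⁻¹ →
        (w : QAS F {τ} c) = oneAddJ F {τ} c x y →
        (w' : QAS F {τ} c) = oneAddJ F {τ} c (-x) (-y) →
        (clsS F {τ} c w)⁻¹ = clsS F {τ} c w') ∧
    (∃ (T : Set (LambdaS F {τ} c)) (hT : T ⊆ PASet F E s {τ} c τ),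
        T.ncard = (Fintype.card F + 1) / 2 ∧
        PASet F E s {τ} c τ = T ∪ T⁻¹ ∧
        Function.Bijective (FreeGroup.lift (fun x : T =>
          (⟨x.1, Subgroup.subset_closure
            (Set.mem_biUnion (Set.mem_singleton τ) (hT x.2))⟩ :
            GammaS F E s {τ} c)))) ∧
    Nonempty ((GammaS F E s {τ} c) ≃* FreeGroup (Fin ((Fintype.card F + 1) / 2))) := by
  have hPA : ∀ {α : E} {x y : F}, hasCoord F E s α x y →
      (α ^ (Fintype.card F + 1) = algebraMap F E τ⁻¹ ↔ x ^ 2 - c * y ^ 2 = τ⁻¹) := by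
    rintro α x y rfl
    rw [coord_pow_card_add_one hq hc hs, (algebraMap F E).injective.eq_iff]
  refine ⟨fun α x y w w' hα hN hw hw' => clsS_inv_eq hτ ((hPA hα).mp hN) hw hw', ?_⟩
  let S := {p : F × F // p.1 ^ 2 - c * p.2 ^ 2 = τ⁻¹}
  let ν : S → S := fun p => ⟨-p.1, by simpa using p.2⟩
  let w : S → (QAS F {τ} c)ˣ := fun p => (isUnit_oneAddJ hτ p.2).unit
  let u : S → LambdaS F {τ} c := fun p => clsS F {τ} c (w p)
  have hν : Function.Involutive ν := fun p => Subtype.ext (neg_neg p.1)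
  have h2 : (2 : F) ≠ 0 := Ring.two_ne_zero (ringChar_ne_two_of_odd_card hq)
  have hfix : ∀ p, ν p ≠ p := by
    rintro ⟨⟨x, y⟩, hp⟩ h
    have h' : (-x, -y) = (x, y) := congrArg Subtype.val h
    obtain ⟨hx, hy⟩ := Prod.mk.inj h'
    have hx0 : x = 0 :=
      (mul_eq_zero.mp (by linear_combination -hx : (2 : F) * x = 0)).resolve_left h2
    have hy0 : y = 0 :=
      (mul_eq_zero.mp (by linear_combination -hy : (2 : F) * y = 0)).resolve_left h2
    refine inv_ne_zero hτ (hp.symm.trans ?_)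
    simp [hx0, hy0]
  have hu : ∀ p, u (ν p) = (u p)⁻¹ := fun p => (clsS_inv_eq hτ p.2 rfl rfl).symm
  have hprod : ∀ L : List S, L ≠ [] → L.IsChain (fun a b => a ≠ ν b) → (L.map u).prod ≠ 1 := by
    intro L hnil hchain h
    have hmap : (L.map u).prod = clsS F {τ} c (L.map w).prod := by
      rw [map_list_prod, List.map_map]
      rfl
    rw [hmap, QuotientGroup.mk'_apply, QuotientGroup.eq_one_iff] at h
    obtain ⟨r, hr⟩ := h
    refine prod_oneAddJ_ne_algebraMap hτ hc (L := L.map Subtype.val) (by simpa using hnil)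
      ?_ ?_ (r : OS F {τ}) ?_
    · intro p hp
      obtain ⟨p, -, rfl⟩ := List.mem_map.mp hp
      exact p.2
    · rw [List.isChain_map]
      exact hchain.imp fun a b hab h => hab (Subtype.ext h)
    · have hr' := congrArg Units.val hr
      refine Eq.trans ?_ hr'.symm
      rw [← Units.coeHom_apply, map_list_prod, List.map_map, List.map_map]
      rfl
  have hrange : PASet F E s {τ} c τ = Set.range u := by
    ext z
    constructor
    · rintro ⟨α, x, y, v, hα, hN, hv, rfl⟩
      refine ⟨⟨(x, y), (hPA hα).mp hN⟩, congrArg _ (Units.ext hv.symm)⟩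
    · rintro ⟨p, rfl⟩
      exact ⟨_, p.1.1, p.1.2, w p, rfl, (hPA rfl).mpr p.2, rfl, rfl⟩
  have hcard : Nat.card S = Fintype.card F + 1 :=
    card_sq_sub_mul_sq_eq hq hc hs hspan (inv_ne_zero hτ)
  obtain ⟨T, hTcard, hTunion, hTinj⟩ := FreeGroup.exists_free_transversal hν hfix hu hprod
  rw [← hrange] at hTunion
  have hn : T.ncard = (Fintype.card F + 1) / 2 := by omega
  have hT : T ⊆ PASet F E s {τ} c τ := hTunion ▸ Set.subset_union_left
  let f : T → GammaS F E s {τ} c := fun x => ⟨x.1, Subgroup.subset_closure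
    (Set.mem_biUnion (Set.mem_singleton τ) (hT x.2))⟩
  have hcomp : (GammaS F E s {τ} c).subtype.comp (FreeGroup.lift f) =
      FreeGroup.lift (Subtype.val : T → LambdaS F {τ} c) := by
    ext x
    simp [f]
  have hbij : Function.Bijective (FreeGroup.lift f) := by
    constructor
    · refine Function.Injective.of_comp (f := (GammaS F E s {τ} c).subtype) ?_
      rw [← MonoidHom.coe_comp, hcomp]
      exact hTinj
    · rintro ⟨z, hz⟩
      have hz' : z ∈ (FreeGroup.lift (Subtype.val : T → LambdaS F {τ} c)).range := by
        rw [FreeGroup.range_lift_eq_closure, Subtype.range_coe]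
        refine (Subgroup.closure_le _).mpr ?_ hz
        simp only [Set.mem_singleton_iff, Set.iUnion_iUnion_eq_left, hTunion]
        rintro v (hv | hv)
        · exact Subgroup.subset_closure hv
        · exact inv_mem_iff.mp (Subgroup.subset_closure hv)
      obtain ⟨g, hg⟩ := hz'
      exact ⟨g, Subtype.ext ((DFunLike.congr_fun hcomp g).trans hg)⟩
  refine ⟨⟨T, hT, hn, hTunion, hbij⟩, ?_⟩
  have hfin : Finite T := by
    refine Set.Finite.subset (Set.finite_range u) ?_
    rw [← hrange]
    exact hT
  have e : T ≃ Fin ((Fintype.card F + 1) / 2) :=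
    Finite.equivFinOfCardEq ((Nat.card_coe_set_eq T).trans hn)
  exact ⟨(MulEquiv.ofBijective _ hbij).symm.trans (FreeGroup.freeGroupCongr e)⟩
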